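/- In U_q(so5), [e_β, \hat f_δ(s)] = f_α^2 · [2]_p [s + h_β + 2]_q q^{-1} / ([s+2]_p [s+1]_p), i.e. the commutator of e_β with the dynamical root vector \hat f_δ(s) equals f_α^2 times the indicated Cartan-valued coefficient, as an identity of operators on weight modules. -/

import Mathlib

noncomputable section

/-- `(u - u⁻¹)/(p - p⁻¹)`; with `u = p^z` this is the q-number `[z]_p`. -/
def qNum (p u : ℂ) : ℂ := (u - u⁻¹) / (p - p⁻¹)

/-- The dynamical root vector
`\hat f_δ(s) = p^{-2}( f_α² f_β [s]_p/[s+2]_p - f_α f_β f_α [2]_p [s]_p/[s+1]_p + f_β f_α² )`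
of `U_q(so5)`, with `t = p^s`. -/
def fdelta (p t : ℂ) {A : Type*} [Ring A] [Algebra ℂ A] (fa fb : A) : A :=
  (p ^ 2)⁻¹ • ((qNum p t / qNum p (t * p ^ 2)) • (fa * fa * fb)
    - (qNum p (p ^ 2) * qNum p t / qNum p (t * p)) • (fa * fb * fa)
    + fb * fa * fa)

/-- The commutator `[e_β, f_β]` acts on a vector of `q^{h_β}`-weight `κ` by the q-number of its
weight. -/
lemma commutator_apply_weight {V : Type*} [AddCommGroup V] [Module ℂ V] {q κ : ℂ} (hκ : κ ≠ 0)
    {E F K Ki : Module.End ℂ V} (hKi : Ki * K = 1)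
    (hEF : E * F - F * E = (q - q⁻¹)⁻¹ • (K - Ki)) {w : V} (hw : K w = κ • w) :
    E (F w) = F (E w) + qNum q κ • w := by
  have hKiw : Ki w = κ⁻¹ • w := by
    have h := LinearMap.congr_fun hKi w
    rw [Module.End.mul_apply, hw, map_smul, Module.End.one_apply] at h
    rw [← h, smul_smul, inv_mul_cancel₀ hκ, one_smul, h]
  have h := LinearMap.congr_fun hEF w
  simp only [LinearMap.sub_apply, Module.End.mul_apply, LinearMap.smul_apply, hw, hKiw] at h
  rw [← sub_eq_iff_eq_add', h, ← sub_smul, smul_smul, qNum, div_eq_inv_mul]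

/-- The q-number identity behind the commutator of `e_β` with the dynamical root vector. -/
lemma qNum_dynamical_identity {p t κ : ℂ} (hp0 : p ≠ 0) (hp : p ^ 4 ≠ 1) (ht : t ≠ 0)
    (hκ : κ ≠ 0) (hden1 : qNum p (t * p) ≠ 0) (hden2 : qNum p (t * p ^ 2) ≠ 0) :
    qNum p t / qNum p (t * p ^ 2) * qNum (p ^ 2) κ
      - qNum p (p ^ 2) * qNum p t / qNum p (t * p) * qNum (p ^ 2) (p ^ 2 * κ)
      + qNum (p ^ 2) (p ^ 2 * (p ^ 2 * κ))
      = qNum p (p ^ 2) * qNum (p ^ 2) (t ^ 2 * κ * p ^ 4) /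
          (qNum p (t * p ^ 2) * qNum p (t * p)) := by
  have h4 : p ^ 4 - 1 ≠ 0 := sub_ne_zero.mpr hp
  have h2 : p ^ 2 - 1 ≠ 0 := fun h => h4 (by linear_combination (p ^ 2 + 1) * h)
  have hd1 : p - p⁻¹ ≠ 0 := fun h => h2 (by field_simp at h; linear_combination h)
  have hd2 : p ^ 2 - (p ^ 2)⁻¹ ≠ 0 := fun h => h4 (by field_simp at h; linear_combination h)
  have key : qNum p t * qNum p (t * p) * qNum (p ^ 2) κ
      - qNum p (p ^ 2) * qNum p t * qNum p (t * p ^ 2) * qNum (p ^ 2) (p ^ 2 * κ)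
      + qNum p (t * p ^ 2) * qNum p (t * p) * qNum (p ^ 2) (p ^ 2 * (p ^ 2 * κ))
      = qNum p (p ^ 2) * qNum (p ^ 2) (t ^ 2 * κ * p ^ 4) := by
    have e1 : p - p⁻¹ = (p ^ 2 - 1) / p := by field_simp
    have e2 : p ^ 2 - (p ^ 2)⁻¹ = (p ^ 4 - 1) / p ^ 2 := by field_simp
    simp only [qNum, e1, e2]
    field_simp
    ring
  rw [eq_div_iff (mul_ne_zero hden2 hden1), ← key]
  field_simp

/-- in `U_q(so5)` (`q = p²`, `α` short, `β` long),
`[e_β, \hat f_δ(s)] = f_α²·[2]_p[s+h_β+2]_q·q^{-1}/([s+2]_p[s+1]_p)` as operators on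
weight modules; here this is evaluated on a weight vector `v` with `q^{h_β} v = κ • v`,
so that `[s+h_β+2]_q` becomes `(t²κq² - t⁻²κ⁻¹q⁻²)/(q-q⁻¹)` with `t = p^s`
(note `q^s = t²`). -/
theorem eb_fdelta_commutator {V : Type*} [AddCommGroup V] [Module ℂ V]
    (p t κ : ℂ) (hp0 : p ≠ 0) (hp : ∀ n : ℕ, 0 < n → p ^ n ≠ 1) (ht : t ≠ 0) (hκ : κ ≠ 0)
    (Eb Fa Fb Kb Kbi : Module.End ℂ V)
    (hK : Kb * Kbi = 1) (hKi : Kbi * Kb = 1)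
    (hKEb : Kb * Eb = ((p ^ 2) ^ 2) • (Eb * Kb))
    (hKFb : Kb * Fb = ((p ^ 2) ^ 2)⁻¹ • (Fb * Kb))
    (hKFa : Kb * Fa = (p ^ 2) • (Fa * Kb))
    (hEbFb : Eb * Fb - Fb * Eb = (p ^ 2 - (p ^ 2)⁻¹)⁻¹ • (Kb - Kbi))
    (hEbFa : Eb * Fa = Fa * Eb)
    (v : V) (hKv : Kb v = κ • v)
    (hden1 : qNum p (t * p) ≠ 0) (hden2 : qNum p (t * p ^ 2) ≠ 0) :
    Eb ((fdelta p t Fa Fb) v) - (fdelta p t Fa Fb) (Eb v)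
      = (qNum p (p ^ 2) * qNum (p ^ 2) (t ^ 2 * κ * p ^ 4) * (p ^ 2)⁻¹ /
          (qNum p (t * p ^ 2) * qNum p (t * p))) • ((Fa * Fa) v) := by
  have hw1 : Kb (Fa v) = (p ^ 2 * κ) • Fa v := by
    simpa [hKv, smul_smul] using LinearMap.congr_fun hKFa v
  have hw2 : Kb (Fa (Fa v)) = (p ^ 2 * (p ^ 2 * κ)) • Fa (Fa v) := by
    simpa [hw1, smul_smul] using LinearMap.congr_fun hKFa (Fa v)
  have hp2 : p ^ 2 ≠ 0 := pow_ne_zero 2 hp0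
  have hκ1 : p ^ 2 * κ ≠ 0 := mul_ne_zero hp2 hκ
  have c0 := commutator_apply_weight hκ hKi hEbFb hKv
  have c1 := commutator_apply_weight hκ1 hKi hEbFb hw1
  have c2 := commutator_apply_weight (mul_ne_zero hp2 hκ1) hKi hEbFb hw2
  have hc : ∀ w, Eb (Fa w) = Fa (Eb w) := LinearMap.congr_fun hEbFa
  rw [mul_div_right_comm,
    ← qNum_dynamical_identity hp0 (hp 4 (by norm_num)) ht hκ hden1 hden2]
  simp only [fdelta, LinearMap.smul_apply, LinearMap.add_apply, LinearMap.sub_apply,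
    Module.End.mul_apply, map_smul, map_add, map_sub, hc, c0, c1, c2]
  module
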